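/- arXiv:2309.15338 — 3 statements merged into one kernel-verified Lean document; each statement's English description precedes it below -/
import Mathlib

section
/- For every ε > 0 there exists a positive integer d_ε such that for all integers d ≥ d_ε, all integers N ≥ 1, and every point a ∈ W, the proportion of ordered pairs (v₁, v₂) ∈ V × V satisfying |dist_d(a, v₁) − dist_d(a, v₂)| ≤ ε is at least 1 − ε. -/
/-- Euclidean distance between two points of `ℝ^d`. -/
noncomputable def dE {d : ℕ} (x y : Fin d → ℝ) : ℝ :=
  Real.sqrt (∑ i, (x i - y i) ^ 2)

/-- Normalized distance `dist(x,y)/(√d · N)`. -/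
noncomputable def dn (d N : ℕ) (x y : Fin d → ℝ) : ℝ :=
  dE x y / (Real.sqrt d * N)

/-- The lattice points `{0,1,…,N}^d` of the hypercube `[0,N]^d`. -/
noncomputable def cubeW (d N : ℕ) : Finset (Fin d → ℝ) :=
  Finset.image (fun f : Fin d → Fin (N + 1) => fun i => (f i : ℝ)) Finset.univ

/-- The `2^d` vertices `{0,N}^d` of the hypercube `[0,N]^d`. -/
noncomputable def cubeV (d N : ℕ) : Finset (Fin d → ℝ) :=
  Finset.image (fun f : Fin d → Bool => fun i => if f i then (N : ℝ) else 0) Finset.univ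

/-- The center `(N/2, …, N/2)` of the hypercube `[0,N]^d`. -/
noncomputable def ctr (d N : ℕ) : Fin d → ℝ := fun _ => (N : ℝ) / 2

/-- Average of squared Euclidean distances from `a` to the vertices. -/
noncomputable def A_V (d N : ℕ) (a : Fin d → ℝ) : ℝ :=
  (∑ v ∈ cubeV d N, dE v a ^ 2) / 2 ^ d

/-- Normalized average of squared distances from `a` to the vertices. -/
noncomputable def B_V (d N : ℕ) (a : Fin d → ℝ) : ℝ :=
  A_V d N a / (d * (N : ℝ) ^ 2)

/-- Average of squared Euclidean distances from `a` to the lattice points. -/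
noncomputable def A_W (d N : ℕ) (a : Fin d → ℝ) : ℝ :=
  (∑ w ∈ cubeW d N, dE w a ^ 2) / ((N : ℝ) + 1) ^ d

/-- Normalized average of squared distances from `a` to the lattice points. -/
noncomputable def B_W (d N : ℕ) (a : Fin d → ℝ) : ℝ :=
  A_W d N a / (d * (N : ℝ) ^ 2)

open Classical in
/-- Number of elements of a finite set satisfying a predicate. -/
noncomputable def pcount {α : Type*} (s : Finset α) (p : α → Prop) : ℕ :=
  (s.filter p).card

open Classical in
/-- Ordered pairs of vertices forming a non-degenerate triangle with `a`. -/
noncomputable def TaV (d N : ℕ) (a : Fin d → ℝ) : Finset ((Fin d → ℝ) × (Fin d → ℝ)) :=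
  ((cubeV d N) ×ˢ (cubeV d N)).filter (fun p => a ≠ p.1 ∧ a ≠ p.2 ∧ p.1 ≠ p.2)

open Classical in
/-- Ordered pairs of lattice points forming a non-degenerate triangle with `a`. -/
noncomputable def TaW (d N : ℕ) (a : Fin d → ℝ) : Finset ((Fin d → ℝ) × (Fin d → ℝ)) :=
  ((cubeW d N) ×ˢ (cubeW d N)).filter (fun p => a ≠ p.1 ∧ a ≠ p.2 ∧ p.1 ≠ p.2)

/-- Cosine of the angle at `c` in the triangle `(a, c, v)`. -/
noncomputable def cosAngleAt {d : ℕ} (c a v : Fin d → ℝ) : ℝ :=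
  (∑ i, (a i - c i) * (v i - c i)) / (dE a c * dE v c)

/-- The Rademacher sign attached to a Boolean. -/
def boolSign (b : Bool) : ℝ := if b then 1 else -1

/-- Second moment of a Rademacher sum. -/
theorem sum_rademacher_sq (d : ℕ) (c : Fin d → ℝ) :
    ∑ f : Fin d → Bool, (∑ i, c i * boolSign (f i)) ^ 2 = 2 ^ d * ∑ i, c i ^ 2 := by
  induction d with
  | zero => simp
  | succ d ih =>
    have h := ih (fun i => c i.succ)
    rw [← (Fin.consEquiv fun _ : Fin (d + 1) => Bool).sum_comp, Fintype.sum_prod_type,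
      Fintype.sum_bool, ← Finset.sum_add_distrib, Fin.sum_univ_succ]
    simp only [Fin.consEquiv, Equiv.coe_fn_mk, Fin.sum_univ_succ (n := d), Fin.cons_zero,
      Fin.cons_succ]
    calc _ = ∑ f : Fin d → Bool,
          (2 * c 0 ^ 2 + 2 * (∑ i : Fin d, c i.succ * boolSign (f i)) ^ 2) := by
          refine Finset.sum_congr rfl fun f _ => ?_
          simp only [boolSign, if_true, Bool.false_eq_true, if_false]
          ring
      _ = _ := by
          rw [Finset.sum_add_distrib, ← Finset.mul_sum, ← Finset.mul_sum, h]
          simp only [Finset.sum_const, Finset.card_univ, Fintype.card_fun, Fintype.card_bool,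
            Fintype.card_fin, nsmul_eq_mul, Nat.cast_pow, Nat.cast_ofNat]
          ring

/-- The sum of squared pairwise differences is at most twice the cardinality times the sum of
squares. -/
theorem sum_sum_sub_sq_le {ι : Type*} [Fintype ι] (S : ι → ℝ) :
    ∑ f, ∑ g, (S f - S g) ^ 2 ≤ 2 * Fintype.card ι * ∑ f, S f ^ 2 := by
  have h : ∑ f, ∑ g, (S f - S g) ^ 2 = 2 * Fintype.card ι * ∑ f, S f ^ 2 - 2 * (∑ f, S f) ^ 2 := by
    simp only [sub_sq, Finset.sum_add_distrib, Finset.sum_sub_distrib, Finset.sum_const,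
      Finset.card_univ, nsmul_eq_mul, ← Finset.mul_sum, ← Finset.sum_mul]
    ring
  rw [h]
  nlinarith [sq_nonneg (∑ f, S f)]

theorem abs_sqrt_sub_sqrt_sq_le {x y : ℝ} (hx : 0 ≤ x) (hy : 0 ≤ y) :
    |√x - √y| ^ 2 ≤ |x - y| := by
  have h : x - y = (√x - √y) * (√x + √y) := by
    nlinarith [Real.sq_sqrt hx, Real.sq_sqrt hy]
  rw [h, abs_mul, sq]
  refine mul_le_mul_of_nonneg_left ?_ (abs_nonneg _)
  rw [abs_of_nonneg (add_nonneg (Real.sqrt_nonneg x) (Real.sqrt_nonneg y)), abs_le]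
  constructor <;> linarith [Real.sqrt_nonneg x, Real.sqrt_nonneg y]

/-- The vertex of `[0,N]^d` whose nonzero coordinates are those selected by `f`. -/
def cubeVertex (d N : ℕ) (f : Fin d → Bool) : Fin d → ℝ := fun i => if f i then (N : ℝ) else 0

theorem cubeVertex_injective {d N : ℕ} (hN : 1 ≤ N) : Function.Injective (cubeVertex d N) := by
  intro f g h
  funext i
  have hi := congrFun h i
  have hN' : (N : ℝ) ≠ 0 := by positivity
  cases hf : f i <;> cases hg : g i <;> simp_all [cubeVertex]

theorem card_cubeV {d N : ℕ} (hN : 1 ≤ N) : (cubeV d N).card = 2 ^ d :=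
  (Finset.card_image_of_injective _ (cubeVertex_injective hN)).trans (by simp)

theorem sum_cubeV {d N : ℕ} (hN : 1 ≤ N) (F : (Fin d → ℝ) → ℝ) :
    ∑ v ∈ cubeV d N, F v = ∑ f, F (cubeVertex d N f) :=
  Finset.sum_image (cubeVertex_injective hN).injOn

theorem dn_nonneg (d N : ℕ) (x y : Fin d → ℝ) : 0 ≤ dn d N x y := by
  unfold dn dE; positivity

theorem dn_sq (d N : ℕ) (x y : Fin d → ℝ) :
    dn d N x y ^ 2 = (∑ i, (x i - y i) ^ 2) / (d * (N : ℝ) ^ 2) := by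
  rw [dn, dE, div_pow, mul_pow, Real.sq_sqrt (by positivity), Real.sq_sqrt (by positivity)]

theorem mem_cubeW_bounds {d N : ℕ} {a : Fin d → ℝ} (ha : a ∈ cubeW d N) (i : Fin d) :
    0 ≤ a i ∧ a i ≤ N := by
  obtain ⟨f, -, rfl⟩ := Finset.mem_image.mp ha
  exact ⟨Nat.cast_nonneg _, Nat.cast_le.mpr (Nat.lt_succ_iff.mp (f i).isLt)⟩

theorem dn_sq_sub_dn_sq_cubeVertex (d N : ℕ) (a : Fin d → ℝ) (f g : Fin d → Bool) :
    dn d N a (cubeVertex d N f) ^ 2 - dn d N a (cubeVertex d N g) ^ 2 =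
      ((∑ i, N * (N - 2 * a i) / 2 * boolSign (f i)) -
        ∑ i, N * (N - 2 * a i) / 2 * boolSign (g i)) / (d * (N : ℝ) ^ 2) := by
  rw [dn_sq, dn_sq, ← sub_div, ← Finset.sum_sub_distrib, ← Finset.sum_sub_distrib]
  congr 1
  refine Finset.sum_congr rfl fun i _ => ?_
  cases hf : f i <;> cases hg : g i <;> simp [cubeVertex, boolSign, hf, hg] <;> ring

theorem sum_dn_sq_sub_dn_sq_sq_le {d N : ℕ} (hd : 0 < d) (hN : 1 ≤ N) {a : Fin d → ℝ}
    (ha : a ∈ cubeW d N) :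
    ∑ p ∈ cubeV d N ×ˢ cubeV d N, (dn d N a p.1 ^ 2 - dn d N a p.2 ^ 2) ^ 2 ≤
      (2 ^ d * 2 ^ d) / (2 * d) := by
  have hN' : (0 : ℝ) < N := by exact_mod_cast hN
  have hd' : (0 : ℝ) < d := by exact_mod_cast hd
  rw [Finset.sum_product]
  simp only [sum_cubeV hN, dn_sq_sub_dn_sq_cubeVertex, div_pow, ← Finset.sum_div]
  have hc : ∑ i, ((N : ℝ) * (N - 2 * a i) / 2) ^ 2 ≤ d * ((N : ℝ) ^ 4 / 4) := by
    calc _ ≤ ∑ _i : Fin d, (N : ℝ) ^ 4 / 4 := by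
          refine Finset.sum_le_sum fun i _ => ?_
          obtain ⟨h0, h1⟩ := mem_cubeW_bounds ha i
          have h : ((N : ℝ) - 2 * a i) ^ 2 ≤ (N : ℝ) ^ 2 := by nlinarith
          nlinarith [mul_le_mul_of_nonneg_left h (sq_nonneg (N : ℝ))]
      _ = _ := by simp
  have h := sum_sum_sub_sq_le
    fun f : Fin d → Bool => ∑ i, (N : ℝ) * (N - 2 * a i) / 2 * boolSign (f i)
  rw [sum_rademacher_sq] at h
  simp only [Fintype.card_fun, Fintype.card_bool, Fintype.card_fin, Nat.cast_pow,
    Nat.cast_ofNat] at h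
  calc _ ≤ (2 * 2 ^ d * (2 ^ d * (d * ((N : ℝ) ^ 4 / 4)))) / (d * (N : ℝ) ^ 2) ^ 2 := by
        gcongr
        exact h.trans (by gcongr)
    _ = _ := by field_simp; norm_num

theorem stmt0 :
    ∀ ε : ℝ, 0 < ε → ∃ dε : ℕ, 0 < dε ∧
      ∀ d N : ℕ, dε ≤ d → 1 ≤ N → ∀ a ∈ cubeW d N,
        (1 : ℝ) - ε ≤
          (pcount ((cubeV d N) ×ˢ (cubeV d N))
              (fun p => |dn d N a p.1 - dn d N a p.2| ≤ ε) : ℝ) /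
            ((cubeV d N) ×ˢ (cubeV d N)).card := by
  classical
  intro ε hε
  obtain ⟨n, hn⟩ := exists_nat_ge (1 / (2 * ε ^ 5))
  refine ⟨n + 1, n.succ_pos, fun d N hd hN a ha => ?_⟩
  have hd0 : 0 < d := by omega
  have hdR : (0 : ℝ) < d := by exact_mod_cast hd0
  have hdε : 1 / (2 * ε ^ 5) ≤ d := hn.trans (by exact_mod_cast (by omega : n ≤ d))
  set P := cubeV d N ×ˢ cubeV d N with hP
  have hcard : (P.card : ℝ) = 2 ^ d * 2 ^ d := by
    rw [hP, Finset.card_product, card_cubeV hN]; push_cast; rfl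
  let good : (Fin d → ℝ) × (Fin d → ℝ) → Prop := fun p => |dn d N a p.1 - dn d N a p.2| ≤ ε
  have hbad : ((P.filter fun p => ¬ good p).card : ℝ) * ε ^ 4 ≤ (2 ^ d * 2 ^ d) / (2 * d) := by
    refine le_trans ?_ (sum_dn_sq_sub_dn_sq_sq_le hd0 hN ha)
    rw [← nsmul_eq_mul]
    refine (Finset.card_nsmul_le_sum _ _ _ fun p hp => ?_).trans
      (Finset.sum_le_sum_of_subset_of_nonneg (Finset.filter_subset _ P)
        fun p _ _ => sq_nonneg (dn d N a p.1 ^ 2 - dn d N a p.2 ^ 2))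
    have hp' : ε < |dn d N a p.1 - dn d N a p.2| := not_le.mp (Finset.mem_filter.mp hp).2
    have h := abs_sqrt_sub_sqrt_sq_le (sq_nonneg (dn d N a p.1)) (sq_nonneg (dn d N a p.2))
    rw [Real.sqrt_sq (dn_nonneg _ _ _ _), Real.sqrt_sq (dn_nonneg _ _ _ _)] at h
    rw [← sq_abs (dn d N a p.1 ^ 2 - dn d N a p.2 ^ 2), show ε ^ 4 = (ε ^ 2) ^ 2 by ring]
    have : ε ^ 2 ≤ |dn d N a p.1 ^ 2 - dn d N a p.2 ^ 2| := le_trans (by gcongr) h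
    gcongr
  have hbad' : ((P.filter fun p => ¬ good p).card : ℝ) ≤ ε * (2 ^ d * 2 ^ d) := by
    refine le_of_mul_le_mul_right (hbad.trans ?_) (pow_pos hε 4)
    rw [div_le_iff₀ (by positivity)] at hdε ⊢
    have hpos : (0 : ℝ) < 2 ^ d * 2 ^ d := by positivity
    nlinarith [mul_le_mul_of_nonneg_left hdε hpos.le]
  have hsplit : ((P.filter good).card : ℝ) + (P.filter fun p => ¬ good p).card = P.card := by
    exact_mod_cast Finset.card_filter_add_card_filter_not (s := P) good
  have hcount : pcount P good = (P.filter good).card := by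
    unfold pcount; congr
  change 1 - ε ≤ (pcount P good : ℝ) / P.card
  rw [hcount, hcard, le_div_iff₀ (by positivity)]
  rw [hcard] at hsplit
  linarith
end

section
/- Let d, N ≥ 1 be integers and let a = (a₁, …, a_d) ∈ ℝ^d. Then the second moment of the squared Euclidean distances from a to the lattice points of the hypercube about their mean A_{a,W}(d,N) satisfies 𝔐₂ = (1/(N+1)^d) Σ_{w ∈ W} (dist(w, a)² − A_{a,W}(d,N))² = (4/45) d N⁴ + ((17/90) d − (1/3) s(a)) N³ + ((1/180) d − (2/3) s(a) + (1/3) ‖a‖²) N² + (−(1/30) d + (2/3) ‖a‖²) N. -/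
theorem sum_fin_succ_fun {α : Type*} [Fintype α] (d : ℕ) (F : (Fin (d + 1) → α) → ℝ) :
    ∑ f, F f = ∑ x : α, ∑ f : Fin d → α, F (Fin.cons x f) := by
  rw [← (Fin.consEquiv fun _ : Fin (d + 1) => α).sum_comp, Fintype.sum_prod_type]
  rfl

/-- Linearity of the mean under the uniform product measure. -/
theorem mean_sum_apply {α : Type*} [Fintype α] [Nonempty α] (d : ℕ) (h : Fin d → α → ℝ) :
    (∑ f : Fin d → α, ∑ i, h i (f i)) / (Fintype.card α : ℝ) ^ d =
      ∑ i, (∑ x, h i x) / (Fintype.card α : ℝ) := by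
  have hc : (Fintype.card α : ℝ) ≠ 0 := by exact_mod_cast Fintype.card_ne_zero
  induction d with
  | zero => simp
  | succ d ih =>
    rw [sum_fin_succ_fun, Fin.sum_univ_succ, ← ih]
    simp only [Fin.sum_univ_succ, Fin.cons_zero, Fin.cons_succ, Finset.sum_add_distrib,
      Finset.sum_const, Finset.card_univ, nsmul_eq_mul, Fintype.card_fun, Fintype.card_fin,
      ← Finset.mul_sum, Nat.cast_pow]
    field_simp
    ring

/-- Additivity of the variance for independent centred uniform variables. -/
theorem mean_sq_sum_apply {α : Type*} [Fintype α] [Nonempty α] (d : ℕ) (g : Fin d → α → ℝ)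
    (hg : ∀ i, ∑ x, g i x = 0) :
    (∑ f : Fin d → α, (∑ i, g i (f i)) ^ 2) / (Fintype.card α : ℝ) ^ d =
      ∑ i, (∑ x, g i x ^ 2) / (Fintype.card α : ℝ) := by
  have hc : (Fintype.card α : ℝ) ≠ 0 := by exact_mod_cast Fintype.card_ne_zero
  induction d with
  | zero => simp
  | succ d ih =>
    rw [sum_fin_succ_fun, Fin.sum_univ_succ, ← ih _ fun i => hg i.succ]
    simp only [Fin.sum_univ_succ, Fin.cons_zero, Fin.cons_succ, add_sq, Finset.sum_add_distrib,
      Finset.sum_const, Finset.card_univ, nsmul_eq_mul, Fintype.card_fun, Fintype.card_fin,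
      ← Finset.mul_sum, ← Finset.sum_mul, hg 0, Nat.cast_pow]
    field_simp
    ring

theorem dE_sq {d : ℕ} (x y : Fin d → ℝ) : dE x y ^ 2 = ∑ i, (x i - y i) ^ 2 :=
  Real.sq_sqrt (Finset.sum_nonneg fun _ _ => sq_nonneg _)

theorem sum_cubeW (d N : ℕ) (F : (Fin d → ℝ) → ℝ) :
    ∑ w ∈ cubeW d N, F w = ∑ f : Fin d → Fin (N + 1), F fun i => (f i : ℝ) := by
  refine Finset.sum_image fun f _ g _ hfg => funext fun i => Fin.ext ?_
  exact_mod_cast congrFun hfg i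

theorem sum_sub_sq (N : ℕ) (b : ℝ) :
    ∑ x : Fin (N + 1), ((x : ℝ) - b) ^ 2 =
      ((N : ℝ) + 1) * ((N : ℝ) * (2 * N + 1) / 6 - N * b + b ^ 2) := by
  rw [Fin.sum_univ_eq_sum_range fun k => ((k : ℝ) - b) ^ 2]
  induction N with
  | zero => simp
  | succ N ih =>
    rw [Finset.sum_range_succ, ih]
    push_cast
    ring

theorem sum_sub_pow_four (N : ℕ) (b : ℝ) :
    ∑ x : Fin (N + 1), ((x : ℝ) - b) ^ 4 =
      ((N : ℝ) + 1) * ((N : ℝ) * (2 * N + 1) * (3 * N ^ 2 + 3 * N - 1) / 30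
        - b * N ^ 2 * (N + 1) + b ^ 2 * N * (2 * N + 1) - 2 * b ^ 3 * N + b ^ 4) := by
  rw [Fin.sum_univ_eq_sum_range fun k => ((k : ℝ) - b) ^ 4]
  induction N with
  | zero => simp; ring
  | succ N ih =>
    rw [Finset.sum_range_succ, ih]
    push_cast
    ring

theorem A_W_eq_sum (d N : ℕ) (a : Fin d → ℝ) :
    A_W d N a = ∑ i, ((N : ℝ) * (2 * N + 1) / 6 - N * a i + a i ^ 2) := by
  have hc : (N : ℝ) + 1 ≠ 0 := by positivity
  have h := mean_sum_apply d fun i (x : Fin (N + 1)) => ((x : ℝ) - a i) ^ 2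
  simp only [Fintype.card_fin, Nat.cast_add, Nat.cast_one, sum_sub_sq,
    mul_div_cancel_left₀ _ hc] at h
  simp only [A_W, sum_cubeW, dE_sq, h]

theorem stmt10 (d N : ℕ) (hd : 1 ≤ d) (hN : 1 ≤ N) (a : Fin d → ℝ) :
    (∑ w ∈ cubeW d N, (dE w a ^ 2 - A_W d N a) ^ 2) / ((N : ℝ) + 1) ^ d =
      (4 / 45) * d * (N : ℝ) ^ 4
        + ((17 / 90) * d - (1 / 3) * (∑ i, a i)) * (N : ℝ) ^ 3
        + ((1 / 180) * d - (2 / 3) * (∑ i, a i) + (1 / 3) * (∑ i, (a i) ^ 2)) * (N : ℝ) ^ 2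
        + (-(1 / 30) * d + (2 / 3) * (∑ i, (a i) ^ 2)) * (N : ℝ) := by
  have hc : (N : ℝ) + 1 ≠ 0 := by positivity
  have h := mean_sq_sum_apply d
    (fun i (x : Fin (N + 1)) =>
      ((x : ℝ) - a i) ^ 2 - ((N : ℝ) * (2 * N + 1) / 6 - N * a i + a i ^ 2))
    fun i => by
      rw [Finset.sum_sub_distrib, sum_sub_sq]
      simp
      ring
  simp only [Fintype.card_fin, Nat.cast_add, Nat.cast_one] at h
  simp only [sum_cubeW, dE_sq, A_W_eq_sum, ← Finset.sum_sub_distrib, h]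
  have hi (i : Fin d) : (∑ x : Fin (N + 1), (((x : ℝ) - a i) ^ 2
      - ((N : ℝ) * (2 * N + 1) / 6 - N * a i + a i ^ 2)) ^ 2) / ((N : ℝ) + 1) =
      ((4 / 45) * (N : ℝ) ^ 4 + (17 / 90) * N ^ 3 + (1 / 180) * N ^ 2 - (1 / 30) * N)
        - ((1 / 3) * (N : ℝ) ^ 3 + (2 / 3) * N ^ 2) * a i
        + ((1 / 3) * (N : ℝ) ^ 2 + (2 / 3) * N) * a i ^ 2 := by
    simp only [sub_sq (_ ^ 2) (_ + _), Finset.sum_add_distrib, Finset.sum_sub_distrib,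
      ← Finset.sum_mul, ← Finset.mul_sum, ← pow_mul, Nat.reduceMul, sum_sub_sq,
      sum_sub_pow_four, Finset.sum_const, Finset.card_univ, Fintype.card_fin, nsmul_eq_mul,
      Nat.cast_add, Nat.cast_one]
    field_simp
    ring
  simp only [hi, Finset.sum_add_distrib, Finset.sum_sub_distrib, ← Finset.mul_sum,
    Finset.sum_const, Finset.card_univ, Fintype.card_fin, nsmul_eq_mul]
  ring
end

section
/- Fix η ∈ (0, 1/2). For any integers d ≥ 2, N ≥ 1, and any point a ∈ ℝ^d with a ∈ [0,N]^d, the proportion of points w ∈ W with dist_d(a, w) ∈ [√B_{a,W} − 1/d^η, √B_{a,W} + 1/d^η] is at least 1 − (51/15)·(1/d^{1−2η}), where B_{a,W} = A_{a,W}(d,N)/(d N²). -/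
/-- If `Y i k ∈ [0, 1]`, the sum of independent uniform samples of the `Y i` has variance
at most its mean. -/
theorem sum_sq_sub_mean_le {ι κ : Type*} [Fintype ι] [DecidableEq ι] [Fintype κ] [Nonempty κ]
    (Y : ι → κ → ℝ) (hY0 : ∀ i k, 0 ≤ Y i k) (hY1 : ∀ i k, Y i k ≤ 1) :
    ∑ f : ι → κ, (∑ i, Y i (f i) -
        (∑ f : ι → κ, ∑ i, Y i (f i)) / Fintype.card (ι → κ)) ^ 2 ≤
      ∑ f : ι → κ, ∑ i, Y i (f i) := by
  set M : ℝ := ((Fintype.card (ι → κ) : ℕ) : ℝ) with hM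
  have hMpos : 0 < M := by rw [hM]; exact_mod_cast Fintype.card_pos
  set m : ι → ℝ := fun i => (∑ f : ι → κ, Y i (f i)) / M with hm
  have hmM : ∀ i, ∑ f : ι → κ, Y i (f i) = M * m i := fun i => by
    rw [hm]; field_simp
  have hcentred : ∀ i, ∑ f : ι → κ, (Y i (f i) - m i) = 0 := fun i => by
    rw [Finset.sum_sub_distrib, hmM i, Finset.sum_const, nsmul_eq_mul, Finset.card_univ, ← hM]
    ring
  have hmarginal : ∀ i, ∑ k, (Y i k - m i) = 0 := fun i => by
    have h := hcentred i
    rw [← (Equiv.funSplitAt i κ).symm.sum_comp, Fintype.sum_prod_type] at h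
    simp only [Equiv.funSplitAt_symm_apply, dite_true, Finset.sum_const, nsmul_eq_mul] at h
    rw [← Finset.mul_sum] at h
    refine (mul_eq_zero.mp h).resolve_left ?_
    exact_mod_cast (Finset.univ_nonempty.card_pos).ne'
  have hcross : ∀ i j, j ≠ i →
      ∑ f : ι → κ, (Y i (f i) - m i) * (Y j (f j) - m j) = 0 := fun i j hij => by
    rw [← (Equiv.funSplitAt i κ).symm.sum_comp, Fintype.sum_prod_type]
    simp only [Equiv.funSplitAt_symm_apply, dite_true, hij, dite_false]
    rw [← Finset.sum_mul_sum, hmarginal, zero_mul]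
  have hdiag : ∀ i, ∑ f : ι → κ, (Y i (f i) - m i) * (Y i (f i) - m i) ≤
      ∑ f : ι → κ, Y i (f i) := fun i => by
    have h : ∑ f : ι → κ, (Y i (f i) - m i) * (Y i (f i) - m i) =
        ∑ f : ι → κ, Y i (f i) ^ 2 - M * m i ^ 2 := by
      have h' : ∀ f : ι → κ, (Y i (f i) - m i) * (Y i (f i) - m i) =
          Y i (f i) ^ 2 - m i ^ 2 - 2 * m i * (Y i (f i) - m i) := fun f => by ring
      simp only [h']
      rw [Finset.sum_sub_distrib, ← Finset.mul_sum, hcentred i, Finset.sum_sub_distrib,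
        Finset.sum_const, nsmul_eq_mul, Finset.card_univ, ← hM]
      ring
    have hsq : ∑ f : ι → κ, Y i (f i) ^ 2 ≤ ∑ f : ι → κ, Y i (f i) :=
      Finset.sum_le_sum fun f _ => by nlinarith [hY0 i (f i), hY1 i (f i)]
    have : 0 ≤ M * m i ^ 2 := by positivity
    linarith
  have hmean : (∑ f : ι → κ, ∑ i, Y i (f i)) / M = ∑ i, m i := by
    rw [Finset.sum_comm, Finset.sum_div]
  calc ∑ f : ι → κ, (∑ i, Y i (f i) - (∑ f : ι → κ, ∑ i, Y i (f i)) / M) ^ 2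
      = ∑ f : ι → κ, ∑ i, ∑ j, (Y i (f i) - m i) * (Y j (f j) - m j) := by
        refine Finset.sum_congr rfl fun f _ => ?_
        rw [hmean, ← Finset.sum_sub_distrib, sq, Finset.sum_mul_sum]
    _ = ∑ i, ∑ j, ∑ f : ι → κ, (Y i (f i) - m i) * (Y j (f j) - m j) := by
        rw [Finset.sum_comm]
        exact Finset.sum_congr rfl fun i _ => Finset.sum_comm
    _ = ∑ i, ∑ f : ι → κ, (Y i (f i) - m i) * (Y i (f i) - m i) :=
        Finset.sum_congr rfl fun i _ =>
          Finset.sum_eq_single i (fun j _ hij => hcross i j hij) (by simp)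
    _ ≤ ∑ i, ∑ f : ι → κ, Y i (f i) := Finset.sum_le_sum fun i _ => hdiag i
    _ = ∑ f : ι → κ, ∑ i, Y i (f i) := Finset.sum_comm

open Classical in
/-- Chebyshev's inequality on the square-root scale, for a nonnegative function whose variance
is at most its mean. -/
theorem card_filter_lt_abs_sqrt_sub_sqrt_le {α : Type*} [Fintype α] [Nonempty α]
    (X : α → ℝ) (hX : ∀ x, 0 ≤ X x)
    (hvar : ∑ x, (X x - (∑ x, X x) / Fintype.card α) ^ 2 ≤ ∑ x, X x)
    {D ε : ℝ} (hD : 0 < D) (hε : 0 < ε) :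
    ((Finset.univ.filter fun x =>
        ε < |√(X x / D) - √((∑ x, X x) / Fintype.card α / D)|).card : ℝ) ≤
      Fintype.card α / (D * ε ^ 2) := by
  set M : ℝ := ((Fintype.card α : ℕ) : ℝ) with hM
  have hMpos : 0 < M := by rw [hM]; exact_mod_cast Fintype.card_pos
  set c : ℝ := (∑ x, X x) / M with hc
  set bad := Finset.univ.filter fun x => ε < |√(X x / D) - √(c / D)| with hbad
  have hsum : ∑ x, X x = M * c := by rw [hc]; field_simp
  have hc0 : 0 ≤ c := div_nonneg (Finset.sum_nonneg fun x _ => hX x) hMpos.le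
  rcases hc0.eq_or_lt with hc0 | hcpos
  · have hzero : ∀ x, X x = 0 := fun x => by
      rw [← hc0, mul_zero] at hsum
      exact (Finset.sum_eq_zero_iff_of_nonneg fun x _ => hX x).mp hsum x (Finset.mem_univ x)
    have : bad = ∅ := by
      rw [hbad, Finset.filter_eq_empty_iff]
      intro x _
      rw [hzero x, ← hc0]
      simpa using hε.le
    rw [this]
    simp only [Finset.card_empty, Nat.cast_zero]
    positivity
  · have hpoint : ∀ x ∈ bad, D * ε ^ 2 * c ≤ (X x - c) ^ 2 := fun x hx => by
      have hx : ε < |√(X x / D) - √(c / D)| := (Finset.mem_filter.mp hx).2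
      have hs := Real.sq_sqrt (div_nonneg (hX x) hD.le)
      have ht := Real.sq_sqrt (div_nonneg hc0 hD.le)
      have hs0 := Real.sqrt_nonneg (X x / D)
      have ht0 := Real.sqrt_nonneg (c / D)
      set s := √(X x / D)
      set t := √(c / D)
      have hXs : X x = D * s ^ 2 := by rw [hs]; field_simp
      have hct : c = D * t ^ 2 := by rw [ht]; field_simp
      have h1 : ε ^ 2 ≤ (s - t) ^ 2 := by
        rw [← sq_abs (s - t)]
        gcongr
      have h2 : t ^ 2 ≤ (s + t) ^ 2 := by
        gcongr
        linarith
      calc D * ε ^ 2 * c = D ^ 2 * (ε ^ 2 * t ^ 2) := by rw [hct]; ring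
        _ ≤ D ^ 2 * ((s - t) ^ 2 * (s + t) ^ 2) := by gcongr
        _ = (X x - c) ^ 2 := by rw [hXs, hct]; ring
    have hchain : bad.card * (D * ε ^ 2 * c) ≤ M * c := by
      rw [← nsmul_eq_mul, ← hsum]
      exact (Finset.card_nsmul_le_sum _ _ _ hpoint).trans
        ((Finset.sum_le_sum_of_subset_of_nonneg (Finset.subset_univ _)
          fun x _ _ => sq_nonneg _).trans hvar)
    rw [le_div_iff₀ (by positivity)]
    refine le_of_mul_le_mul_right ?_ hcpos
    linarith

/-- The lattice point of the cube with coordinates `f`. -/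
def latticePoint {d N : ℕ} (f : Fin d → Fin (N + 1)) : Fin d → ℝ := fun i => (f i : ℝ)

theorem latticePoint_injective {d N : ℕ} :
    Function.Injective (latticePoint : (Fin d → Fin (N + 1)) → Fin d → ℝ) := fun f g h => by
  funext i
  have : ((f i : ℕ) : ℝ) = (g i : ℕ) := congrFun h i
  exact Fin.ext (by exact_mod_cast this)

theorem cubeW_eq_image (d N : ℕ) :
    cubeW d N = Finset.univ.image (latticePoint : (Fin d → Fin (N + 1)) → Fin d → ℝ) := rfl

theorem card_cubeW (d N : ℕ) : (cubeW d N).card = Fintype.card (Fin d → Fin (N + 1)) := by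
  rw [cubeW_eq_image, Finset.card_image_of_injective _ latticePoint_injective, Finset.card_univ]

open Classical in
theorem pcount_cubeW (d N : ℕ) (p : (Fin d → ℝ) → Prop) :
    pcount (cubeW d N) p =
      (Finset.univ.filter fun f : Fin d → Fin (N + 1) => p (latticePoint f)).card := by
  rw [pcount, cubeW_eq_image, Finset.filter_image,
    Finset.card_image_of_injective _ latticePoint_injective]

theorem dn_eq_sqrt {d N : ℕ} (x y : Fin d → ℝ) :
    dn d N x y = √((∑ i, ((y i - x i) / N) ^ 2) / d) := by
  have h : (∑ i, ((y i - x i) / N) ^ 2) / d = (∑ i, (x i - y i) ^ 2) / (d * (N : ℝ) ^ 2) := by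
    rw [mul_comm (d : ℝ), ← div_div, Finset.sum_div Finset.univ _ ((N : ℝ) ^ 2)]
    congr 1
    exact Finset.sum_congr rfl fun i _ => by ring
  rw [dn, dE, h, Real.sqrt_div (Finset.sum_nonneg fun i _ => sq_nonneg _),
    Real.sqrt_mul (Nat.cast_nonneg d), Real.sqrt_sq (Nat.cast_nonneg N)]

theorem B_W_eq (d N : ℕ) (a : Fin d → ℝ) :
    B_W d N a = (∑ f : Fin d → Fin (N + 1), ∑ i, (((f i : ℝ) - a i) / N) ^ 2) /
      Fintype.card (Fin d → Fin (N + 1)) / d := by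
  have h : ∀ f : Fin d → Fin (N + 1),
      ∑ i, (((f i : ℝ) - a i) / N) ^ 2 = dE (latticePoint f) a ^ 2 / (N : ℝ) ^ 2 := fun f => by
    rw [dE, Real.sq_sqrt (Finset.sum_nonneg fun i _ => sq_nonneg _), Finset.sum_div]
    exact Finset.sum_congr rfl fun i _ => div_pow _ _ _
  rw [B_W, A_W, cubeW_eq_image, Finset.sum_image latticePoint_injective.injOn]
  simp only [h]
  rw [← Finset.sum_div]
  simp only [Fintype.card_pi, Fintype.card_fin, Finset.prod_const, Finset.card_univ]
  push_cast
  simp only [div_div]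
  congr 1
  ring

theorem stmt11 (η : ℝ) (hη : η ∈ Set.Ioo (0 : ℝ) (1 / 2)) (d N : ℕ) (hd : 2 ≤ d) (hN : 1 ≤ N)
    (a : Fin d → ℝ) (ha : ∀ i, a i ∈ Set.Icc (0 : ℝ) N) :
    (1 : ℝ) - (51 / 15) * (1 / (d : ℝ) ^ ((1 : ℝ) - 2 * η)) ≤
      (pcount (cubeW d N) (fun w =>
          dn d N a w ∈ Set.Icc (Real.sqrt (B_W d N a) - 1 / (d : ℝ) ^ η)
            (Real.sqrt (B_W d N a) + 1 / (d : ℝ) ^ η)) : ℝ) / (cubeW d N).card := by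
  classical
  have hdpos : (0 : ℝ) < d := by exact_mod_cast (by omega : 0 < d)
  have hNpos : (0 : ℝ) < N := by exact_mod_cast hN
  set ε : ℝ := 1 / (d : ℝ) ^ η with hε
  have hεpos : 0 < ε := by positivity
  have hpow : (d : ℝ) * ε ^ 2 = (d : ℝ) ^ (1 - 2 * η) := by
    rw [hε, Real.rpow_sub hdpos, Real.rpow_one, mul_comm 2 η, Real.rpow_mul hdpos.le,
      Real.rpow_two]
    ring
  have hY1 : ∀ i (k : Fin (N + 1)), (((k : ℝ) - a i) / N) ^ 2 ≤ 1 := fun i k => by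
    have hk : ((k : ℕ) : ℝ) ≤ N := by exact_mod_cast Nat.lt_succ_iff.mp k.isLt
    have hk0 : (0 : ℝ) ≤ (k : ℕ) := Nat.cast_nonneg _
    obtain ⟨h0, h1⟩ := ha i
    rw [sq_le_one_iff_abs_le_one, abs_le, le_div_iff₀ hNpos, div_le_one hNpos]
    constructor <;> linarith
  have hbad := card_filter_lt_abs_sqrt_sub_sqrt_le
    (fun f : Fin d → Fin (N + 1) => ∑ i, (((f i : ℝ) - a i) / N) ^ 2)
    (fun f => Finset.sum_nonneg fun i _ => sq_nonneg _)
    (sum_sq_sub_mean_le (fun i (k : Fin (N + 1)) => (((k : ℝ) - a i) / N) ^ 2)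
      (fun i k => sq_nonneg _) hY1) hdpos hεpos
  rw [← B_W_eq, hpow] at hbad
  set M : ℝ := ((Fintype.card (Fin d → Fin (N + 1)) : ℕ) : ℝ) with hM
  have hMpos : 0 < M := by rw [hM]; exact_mod_cast Fintype.card_pos
  have hnot : ∀ f : Fin d → Fin (N + 1),
      (¬ dn d N a (latticePoint f) ∈ Set.Icc (√(B_W d N a) - ε) (√(B_W d N a) + ε)) ↔
        ε < |√((∑ i, (((f i : ℝ) - a i) / N) ^ 2) / d) - √(B_W d N a)| := fun f => by
    rw [← not_le, not_iff_not, dn_eq_sqrt, abs_sub_comm, ← Set.mem_Icc_iff_abs_le]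
    rfl
  have hsplit : pcount (cubeW d N)
        (fun w => dn d N a w ∈ Set.Icc (√(B_W d N a) - ε) (√(B_W d N a) + ε)) +
      (Finset.univ.filter fun f : Fin d → Fin (N + 1) =>
        ε < |√((∑ i, (((f i : ℝ) - a i) / N) ^ 2) / d) - √(B_W d N a)|).card =
      Fintype.card (Fin d → Fin (N + 1)) := by
    have h := Finset.card_filter_add_card_filter_not
      (s := (Finset.univ : Finset (Fin d → Fin (N + 1))))
      (fun f => dn d N a (latticePoint f) ∈ Set.Icc (√(B_W d N a) - ε) (√(B_W d N a) + ε))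
    simp only [hnot] at h
    rw [pcount_cubeW, ← Finset.card_univ]
    convert h
  rw [card_cubeW, ← hM, le_div_iff₀ hMpos]
  have hsplit' := congrArg (Nat.cast : ℕ → ℝ) hsplit
  rw [Nat.cast_add, ← hM] at hsplit'
  have hle : M / (d : ℝ) ^ (1 - 2 * η) ≤ 51 / 15 * (1 / (d : ℝ) ^ (1 - 2 * η)) * M := by
    have : 0 < M / (d : ℝ) ^ (1 - 2 * η) := by positivity
    calc M / (d : ℝ) ^ (1 - 2 * η) ≤ 51 / 15 * (M / (d : ℝ) ^ (1 - 2 * η)) := by linarith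
      _ = _ := by ring
  linarith
end
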